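/- arXiv:1804.00975 — 4 statements merged into one kernel-verified Lean document; each statement's English description precedes it below -/
import Mathlib

section
/- Let R be a commutative ring and M a finitely generated projective module over the polynomial ring R[X]. Then for each p ∈ ℕ, the R-module M[p] = X^pM / X^{p+1}M is finitely generated and projective over R. -/
open Polynomial

/-- `XpM R M p` is the `R[X]`-submodule `X^p • M` of `M`, i.e. the image of `M` under
scalar multiplication by `X^p`. -/
noncomputable abbrev XpM (R : Type*) [CommRing R] (M : Type*) [AddCommGroup M]
    [Module (Polynomial R) M] (p : ℕ) : Submodule (Polynomial R) M :=
  LinearMap.range (LinearMap.lsmul (Polynomial R) M ((X : Polynomial R) ^ p))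

/-- The elements of `X^p M` that lie in `X^q M`, as a submodule of `X^p M`. -/
noncomputable abbrev XpMsub (R : Type*) [CommRing R] (M : Type*) [AddCommGroup M]
    [Module (Polynomial R) M] (p q : ℕ) : Submodule (Polynomial R) (XpM R M p) :=
  (XpM R M q).comap (XpM R M p).subtype

/-- Split `F` into its constant coefficients and a multiple of `X`. -/
theorem Polynomial.exists_pi_eq_C_add_X_smul {R ι : Type*} [CommRing R] (F : ι → R[X]) :
    ∃ H : ι → R[X], F = (fun i => C ((F i).coeff 0)) + (X : R[X]) • H :=
  ⟨fun i => (F i).divX, _root_.funext fun i => by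
    simp [add_comm (C _), X_mul_divX_add]⟩

/-- Let `R` be a commutative ring and `M` a finitely generated projective
module over `R[X]`.  Then for each `p ∈ ℕ`, the `R`-module `M[p] = X^p M / X^{p+1} M` is
finitely generated and projective over `R`. -/
theorem graded_piece_fg_projective (R : Type*) [CommRing R]
    (M : Type*) [AddCommGroup M] [Module R M] [Module (Polynomial R) M]
    [IsScalarTower R (Polynomial R) M]
    [Module.Finite (Polynomial R) M] [Module.Projective (Polynomial R) M] (p : ℕ) :
    Module.Finite R (XpM R M p ⧸ XpMsub R M p (p + 1)) ∧
    Module.Projective R (XpM R M p ⧸ XpMsub R M p (p + 1)) := by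
  obtain ⟨n, g, e, -, -, hge⟩ := Module.Finite.exists_comp_eq_id_of_projective R[X] M
  -- on `X ^ p M`, the `p`-th coefficients in the free module `R[X] ^ n`
  let s₀ : XpM R M p →ₗ[R] Fin n → R :=
    LinearMap.pi fun i => lcoeff R p ∘ₗ LinearMap.proj i ∘ₗ
      e.restrictScalars R ∘ₗ (XpM R M p).subtype.restrictScalars R
  have hs₀ : (XpMsub R M p (p + 1)).restrictScalars R ≤ LinearMap.ker s₀ := by
    rintro ⟨x, hx⟩ ⟨m, hm⟩
    obtain rfl : (X : R[X]) ^ (p + 1) • m = x := hm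
    ext i
    simp [s₀, coeff_X_pow_mul']
  let s : (XpM R M p ⧸ XpMsub R M p (p + 1)) →ₗ[R] Fin n → R :=
    Submodule.liftQ _ s₀ hs₀ ∘ₗ
      (Submodule.Quotient.restrictScalarsEquiv R (XpMsub R M p (p + 1))).symm.toLinearMap
  let π : M →ₗ[R[X]] XpM R M p ⧸ XpMsub R M p (p + 1) :=
    (XpMsub R M p (p + 1)).mkQ ∘ₗ (LinearMap.lsmul R[X] M (X ^ p)).rangeRestrict
  have hπ : Function.Surjective π :=
    (Submodule.mkQ_surjective _).comp (LinearMap.surjective_rangeRestrict _)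
  have hπX (m : M) : π ((X : R[X]) • m) = 0 := by
    refine (Submodule.Quotient.mk_eq_zero _).2 ⟨m, ?_⟩
    change (X : R[X]) ^ (p + 1) • m = (X : R[X]) ^ p • (X : R[X]) • m
    rw [pow_succ, mul_smul]
  let q : (Fin n → R) →ₗ[R] XpM R M p ⧸ XpMsub R M p (p + 1) :=
    (π ∘ₗ g).restrictScalars R ∘ₗ
      LinearMap.pi fun i => (Algebra.linearMap R R[X]) ∘ₗ LinearMap.proj i
  have hq (c : Fin n → R) : q c = π (g fun i => C (c i)) := rfl
  have hs (m : M) : s (π m) = fun i => (e m i).coeff 0 := by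
    have h : s (π m) = fun i => (e ((X : R[X]) ^ p • m) i).coeff p := rfl
    rw [h]
    simp [coeff_X_pow_mul']
  have hqs : q ∘ₗ s = LinearMap.id := by
    refine LinearMap.ext fun y => ?_
    obtain ⟨m, rfl⟩ := hπ y
    obtain ⟨H, hH⟩ := exists_pi_eq_C_add_X_smul (e m)
    have hm : g (e m) = m := LinearMap.congr_fun hge m
    rw [LinearMap.comp_apply, hs, hq, LinearMap.id_apply]
    conv_rhs => rw [← hm, hH, map_add, map_smul, map_add, hπX, add_zero]
  exact ⟨Module.Finite.of_surjective q
    (LinearMap.surjective_of_comp_eq_id s q hqs), Module.Projective.of_split s q hqs⟩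
end

section
/- Let R be a commutative ring, M a finitely generated projective module over the polynomial ring R[X], and m < n natural numbers. Then there is an isomorphism of R-modules M[m,n] ≅ ⊕_{m ≤ p < n} M[p], where M[m,n] denotes X^mM / X^nM and M[p] denotes X^pM / X^{p+1}M. -/
open Polynomial

/-- For a projective `R[X]`-module `M`, taking the coefficient of `X ^ p` in a free module containing
`M` as a direct summand gives an `R`-linear endomorphism of `M` with image in `X ^ p M`, which
vanishes on `X ^ (p + 1) M` and is the identity modulo `X ^ (p + 1) M` on `X ^ p M`. -/
theorem exists_linearMap_splitting_XpM (R : Type*) [CommRing R]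
    (M : Type*) [AddCommGroup M] [Module R M] [Module (Polynomial R) M]
    [IsScalarTower R (Polynomial R) M] [Module.Projective (Polynomial R) M] (p : ℕ) :
    ∃ e : M →ₗ[R] M, (∀ v, e v ∈ XpM R M p) ∧ (∀ v ∈ XpM R M (p + 1), e v = 0) ∧
      ∀ v ∈ XpM R M p, v - e v ∈ XpM R M (p + 1) := by
  obtain ⟨i, hi⟩ := Module.projective_def.mp (inferInstance : Module.Projective R[X] M)
  let π : (M →₀ R[X]) →ₗ[R[X]] M := Finsupp.linearCombination R[X] id
  have hi' : ∀ v, π (i v) = v := hi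
  let c : (M →₀ R[X]) →ₗ[R] (M →₀ R[X]) :=
    Finsupp.mapRange.linearMap (monomial p ∘ₗ lcoeff R p)
  refine ⟨π.restrictScalars R ∘ₗ c ∘ₗ i.restrictScalars R, fun v => ?_, ?_, ?_⟩
  · have h : c (i v) =
        (X : R[X]) ^ p • (i v).mapRange (fun q => C (q.coeff p)) (by simp) := by
      ext1 a
      simp [c, X_pow_mul_C, C_mul_X_pow_eq_monomial]
    refine ⟨π ((i v).mapRange (fun q => C (q.coeff p)) (by simp)), ?_⟩
    simp [h]
  · rintro _ ⟨u, rfl⟩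
    have h : c ((X : R[X]) ^ (p + 1) • i u) = 0 := by
      ext1 a
      simp [c, coeff_X_pow_mul']
    simp [h]
  · rintro _ ⟨u, rfl⟩
    have h : (X : R[X]) ^ p • i u - c ((X : R[X]) ^ p • i u) =
        (X : R[X]) ^ (p + 1) • (i u).mapRange divX (by simp) := by
      ext1 a
      have hX := X_mul_divX_add (i u a)
      simp only [c, Finsupp.coe_sub, Pi.sub_apply, Finsupp.smul_apply, smul_eq_mul,
        Finsupp.mapRange.linearMap_apply, Finsupp.mapRange_apply, LinearMap.comp_apply,
        lcoeff_apply, coeff_X_pow_mul', le_refl, if_true, Nat.sub_self,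
        ← C_mul_X_pow_eq_monomial]
      linear_combination (-(X : R[X]) ^ p) * hX
    refine ⟨π ((i u).mapRange divX (by simp)), ?_⟩
    have h' := congrArg π h
    simp only [map_sub, map_smul, hi'] at h'
    simpa using h'.symm

theorem XpM_antitone (R : Type*) [CommRing R] (M : Type*) [AddCommGroup M]
    [Module (Polynomial R) M] : Antitone (XpM R M) := by
  rintro p q hpq _ ⟨u, rfl⟩
  refine ⟨(X : R[X]) ^ (q - p) • u, ?_⟩
  simp [smul_smul, ← pow_add, Nat.sub_add_cancel hpq]

/-- The first isomorphism theorem over `R` for a map whose kernel is an `A`-submodule. -/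
theorem nonempty_quotient_linearEquiv_of_ker_eq {R A V P : Type*} [Ring R] [Ring A] [SMul R A]
    [AddCommGroup V] [Module R V] [Module A V] [IsScalarTower R A V]
    [AddCommMonoid P] [Module R P] (S : Submodule A V) (f : V →ₗ[R] P)
    (hf : Function.Surjective f) (hker : LinearMap.ker f = S.restrictScalars R) :
    Nonempty ((V ⧸ S) ≃ₗ[R] P) := by
  let _ : AddCommGroup P := Module.addCommMonoidToAddCommGroup R
  exact ⟨(Submodule.Quotient.restrictScalarsEquiv R S).symm ≪≫ₗ
    Submodule.quotEquivOfEq _ _ hker.symm ≪≫ₗ f.quotKerEquivOfSurjective hf⟩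

/-- A jointly surjective finite family of `R`-linear maps, whose common kernel is an `A`-submodule
`S`, identifies the quotient by `S` with the direct sum of the codomains. -/
theorem nonempty_quotient_linearEquiv_directSum {R A V ι : Type*} [Ring R] [Ring A] [SMul R A]
    [AddCommGroup V] [Module R V] [Module A V] [IsScalarTower R A V] [Fintype ι]
    {N : ι → Type*} [∀ i, AddCommMonoid (N i)] [∀ i, Module R (N i)] (S : Submodule A V)
    (f : ∀ i, V →ₗ[R] N i) (hf : ∀ y : ∀ i, N i, ∃ v, ∀ i, f i v = y i)
    (hker : ∀ v, (∀ i, f i v = 0) ↔ v ∈ S) :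
    Nonempty ((V ⧸ S) ≃ₗ[R] DirectSum ι N) := by
  classical
  obtain ⟨φ⟩ := nonempty_quotient_linearEquiv_of_ker_eq S (LinearMap.pi f)
    (fun y => (hf y).imp fun _ => funext) (by ext v; simp [← hker, funext_iff])
  exact ⟨φ ≪≫ₗ (DirectSum.linearEquivFunOnFintype R ι N).symm⟩

/-- Let `R` be a commutative ring, `M` a finitely generated projective
module over `R[X]`, and `m < n` natural numbers.  Then there is an isomorphism of
`R`-modules `M[m,n] ≅ ⊕_{m ≤ p < n} M[p]`, where `M[m,n] = X^m M / X^n M` and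
`M[p] = X^p M / X^{p+1} M`. -/
theorem filtration_quotient_iso_direct_sum_of_graded_pieces (R : Type*) [CommRing R]
    (M : Type*) [AddCommGroup M] [Module R M] [Module (Polynomial R) M]
    [IsScalarTower R (Polynomial R) M]
    [Module.Finite (Polynomial R) M] [Module.Projective (Polynomial R) M]
    (m n : ℕ) (hmn : m < n) :
    Nonempty ((XpM R M m ⧸ XpMsub R M m n) ≃ₗ[R]
      DirectSum (Finset.Ico m n)
        (fun p => XpM R M (p : ℕ) ⧸ XpMsub R M (p : ℕ) ((p : ℕ) + 1))) := by
  choose e he_mem he_zero he_sub using exists_linearMap_splitting_XpM R M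
  let f : (p : Finset.Ico m n) → XpM R M m →ₗ[R]
      XpM R M (p : ℕ) ⧸ XpMsub R M (p : ℕ) ((p : ℕ) + 1) :=
    fun p => (XpMsub R M (p : ℕ) ((p : ℕ) + 1)).mkQ.restrictScalars R ∘ₗ
      LinearMap.codRestrict ((XpM R M (p : ℕ)).restrictScalars R)
        (e p ∘ₗ (XpM R M m).subtype.restrictScalars R) (fun v => he_mem p v)
  have hf : ∀ v p, f p v = Submodule.Quotient.mk ⟨e p v, he_mem p v⟩ := fun _ _ => rfl
  refine nonempty_quotient_linearEquiv_directSum (XpMsub R M m n) f ?_ fun v => ?_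
  · intro y
    choose w hw using fun p => Submodule.Quotient.mk_surjective _ (y p)
    have key : ∀ k, m ≤ k → k ≤ n → ∃ v ∈ XpM R M m, ∀ p : Finset.Ico m n, (p : ℕ) < k →
        e p v - w p ∈ XpM R M (p + 1) := by
      intro k hk
      induction k, hk using Nat.le_induction with
      | base =>
        exact fun _ => ⟨0, zero_mem _, fun p hp =>
          absurd (Finset.mem_Ico.mp p.2).1 (by omega)⟩
      | succ k hk ih =>
        intro hkn
        obtain ⟨v, hv, hvw⟩ := ih (by omega)
        let q : Finset.Ico m n := ⟨k, Finset.mem_Ico.mpr ⟨hk, hkn⟩⟩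
        have hu : (w q : M) - e k v ∈ XpM R M k := sub_mem (w q).2 (he_mem k v)
        refine ⟨v + (w q - e k v), add_mem hv (XpM_antitone R M hk hu), fun p hp => ?_⟩
        rcases Nat.lt_succ_iff_lt_or_eq.mp hp with hlt | heq
        · rw [map_add, he_zero p _ (XpM_antitone R M hlt hu), add_zero]
          exact hvw p hlt
        · obtain rfl : p = q := Subtype.ext heq
          have h := neg_mem (he_sub k _ hu)
          rw [map_add]
          convert h using 1
          change e k v + _ - _ = _
          abel
    obtain ⟨v, hv, hvw⟩ := key n hmn.le le_rfl
    refine ⟨⟨v, hv⟩, fun p => ?_⟩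
    rw [hf, ← hw p, Submodule.Quotient.eq]
    exact hvw p (Finset.mem_Ico.mp p.2).2
  · constructor
    · intro hv
      have key : ∀ k, m ≤ k → k ≤ n → (v : M) ∈ XpM R M k := by
        intro k hk
        induction k, hk using Nat.le_induction with
        | base => exact fun _ => v.2
        | succ k hk ih =>
          intro hkn
          have h := hv ⟨k, Finset.mem_Ico.mpr ⟨hk, hkn⟩⟩
          rw [hf, Submodule.Quotient.mk_eq_zero] at h
          have h' : e k v ∈ XpM R M (k + 1) := h
          simpa using add_mem (he_sub k v (ih (by omega))) h'
      exact key n hmn.le le_rfl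
    · intro hv p
      rw [hf, Submodule.Quotient.mk_eq_zero]
      have h0 : e p v = 0 :=
        he_zero p v (XpM_antitone R M (Finset.mem_Ico.mp p.2).2 hv)
      change e p v ∈ XpM R M (p + 1)
      rw [h0]
      exact zero_mem _
end

section
/- Let R be a commutative ring and M a finitely generated projective module over the polynomial ring R[X]. Then there is an isomorphism of R-modules M ≅ (M/XM) ⊕ M. (Indeed, the short exact sequence 0 → XM → M → M/XM → 0 of R-modules splits because M/XM is projective over R, and multiplication by X gives an R-module isomorphism M ≅ XM.) -/
open Polynomial

/-- `XM R M` is the `R[X]`-submodule `X • M` of `M`, i.e. the image of `M` under scalar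
multiplication by `X`. -/
noncomputable abbrev XM (R : Type*) [CommRing R] (M : Type*) [AddCommGroup M]
    [Module (Polynomial R) M] : Submodule (Polynomial R) M :=
  LinearMap.range (LinearMap.lsmul (Polynomial R) M (X : Polynomial R))

/-- Division by `X` on polynomials, as an `R`-linear map. -/
noncomputable def Polynomial.divXLinearMap (R : Type*) [CommRing R] : R[X] →ₗ[R] R[X] where
  toFun := divX
  map_add' _ _ := divX_add
  map_smul' a p := by simp [smul_eq_C_mul]

/-- Multiplication by `X` on a projective `R[X]`-module has an `R`-linear left inverse. -/
theorem exists_leftInverse_X_smul (R : Type*) [CommRing R]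
    (M : Type*) [AddCommGroup M] [Module R M] [Module R[X] M] [IsScalarTower R R[X] M]
    [Module.Projective R[X] M] :
    ∃ l : M →ₗ[R] M, Function.LeftInverse l fun m ↦ (X : R[X]) • m := by
  obtain ⟨s, hs⟩ := Module.projective_def'.mp (inferInstance : Module.Projective R[X] M)
  let d : (M →₀ R[X]) →ₗ[R] (M →₀ R[X]) := Finsupp.mapRange.linearMap (divXLinearMap R)
  have hd (f : M →₀ R[X]) : d ((X : R[X]) • f) = f := by
    ext1 i
    ext1 n
    simp [d, divXLinearMap, coeff_divX]
  refine ⟨(Finsupp.linearCombination R[X] id).restrictScalars R ∘ₗ d ∘ₗ s.restrictScalars R,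
    fun m ↦ ?_⟩
  simpa [hd] using LinearMap.congr_fun hs m

/-- Let `R` be a commutative ring and `M` a finitely generated projective
module over `R[X]`.  Then there is an isomorphism of `R`-modules `M ≅ (M/XM) ⊕ M`. -/
theorem absorption_iso (R : Type*) [CommRing R]
    (M : Type*) [AddCommGroup M] [Module R M] [Module (Polynomial R) M]
    [IsScalarTower R (Polynomial R) M]
    [Module.Finite (Polynomial R) M] [Module.Projective (Polynomial R) M] :
    Nonempty (M ≃ₗ[R] (M ⧸ XM R M) × M) := by
  obtain ⟨l, hl⟩ := exists_leftInverse_X_smul R M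
  replace hl (m : M) : l ((X : R[X]) • m) = m := hl m
  refine ⟨LinearEquiv.ofBijective (((XM R M).mkQ.restrictScalars R).prod l) ⟨?_, ?_⟩⟩
  · rw [injective_iff_map_eq_zero]
    intro m hm
    obtain ⟨h₁, h₂⟩ := Prod.mk.inj hm
    obtain ⟨n, rfl⟩ := (Submodule.Quotient.mk_eq_zero (XM R M)).mp h₁
    have hn : n = 0 := (hl n).symm.trans h₂
    simp [hn]
  · rintro ⟨q, b⟩
    obtain ⟨a, rfl⟩ := Submodule.Quotient.mk_surjective _ q
    refine ⟨a + (X : R[X]) • (b - l a), Prod.ext ?_ ?_⟩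
    · refine (Submodule.Quotient.eq (XM R M)).mpr ⟨b - l a, ?_⟩
      simp
    · simp [hl]
end

section
/- Let R be a commutative ring, P a finitely generated R-module, Q an R-module, and α : P ⊗_R R[T,T⁻¹] → Q ⊗_R R[T,T⁻¹] an R[T,T⁻¹]-linear map between the base changes to the Laurent polynomial ring. Then there exists N ∈ ℕ such that for every p ∈ ℤ, α maps the R-submodule P ⊗ T^p of P ⊗_R R[T,T⁻¹] into the R-submodule Σ_{q=p−N}^{p+N} Q ⊗ T^q of Q ⊗_R R[T,T⁻¹]. -/
/-- The `R`-submodule `P ⊗ T^p` of elementary tensors `T^p ⊗ x` in the base change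
`R[T,T⁻¹] ⊗_R P` of an `R`-module `P` to the Laurent polynomial ring. -/
noncomputable abbrev tensorTPow (R : Type*) [CommRing R] (P : Type*) [AddCommGroup P]
    [Module R P] (p : ℤ) : Submodule R (TensorProduct R (LaurentPolynomial R) P) :=
  LinearMap.range (TensorProduct.mk R (LaurentPolynomial R) P (LaurentPolynomial.T p))

/-- The span of the degrees in `[-N, N]` grows with `N`. -/
theorem iSup_Icc_tensorTPow_mono {R : Type*} [CommRing R] {Q : Type*} [AddCommGroup Q]
    [Module R Q] {M N : ℕ} (h : M ≤ N) :
    (⨆ q ∈ Finset.Icc (-(M : ℤ)) M, tensorTPow R Q q) ≤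
      ⨆ q ∈ Finset.Icc (-(N : ℤ)) N, tensorTPow R Q q :=
  biSup_mono fun q hq => by
    rw [Finset.mem_Icc] at hq ⊢
    omega

open scoped TensorProduct in
open LaurentPolynomial in
/-- Every element of `R[T,T⁻¹] ⊗_R Q` is supported in finitely many degrees. -/
theorem exists_mem_iSup_Icc_tensorTPow {R : Type*} [CommRing R] {Q : Type*} [AddCommGroup Q]
    [Module R Q] (z : R[T;T⁻¹] ⊗[R] Q) :
    ∃ N : ℕ, z ∈ ⨆ q ∈ Finset.Icc (-(N : ℤ)) N, tensorTPow R Q q := by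
  have add : ∀ {x y : R[T;T⁻¹] ⊗[R] Q},
      (∃ N : ℕ, x ∈ ⨆ q ∈ Finset.Icc (-(N : ℤ)) N, tensorTPow R Q q) →
      (∃ N : ℕ, y ∈ ⨆ q ∈ Finset.Icc (-(N : ℤ)) N, tensorTPow R Q q) →
      ∃ N : ℕ, x + y ∈ ⨆ q ∈ Finset.Icc (-(N : ℤ)) N, tensorTPow R Q q := by
    rintro x y ⟨M, hx⟩ ⟨N, hy⟩
    exact ⟨max M N, add_mem (iSup_Icc_tensorTPow_mono (le_max_left M N) hx)
      (iSup_Icc_tensorTPow_mono (le_max_right M N) hy)⟩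
  induction z using TensorProduct.induction_on with
  | zero => exact ⟨0, zero_mem _⟩
  | add x y hx hy => exact add hx hy
  | tmul f x =>
    induction f using LaurentPolynomial.induction_on' with
    | add f g hf hg =>
      rw [TensorProduct.add_tmul]
      exact add hf hg
    | C_mul_T n a =>
      refine ⟨n.natAbs, Submodule.mem_iSup_of_mem n (Submodule.mem_iSup_of_mem ?_ ⟨a • x, ?_⟩)⟩
      · rw [Finset.mem_Icc]
        omega
      · rw [TensorProduct.mk_apply, TensorProduct.tmul_smul, TensorProduct.smul_tmul',
          LaurentPolynomial.smul_eq_C_mul]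

open scoped TensorProduct in
open LaurentPolynomial in
/-- Multiplication by `T^p` shifts degrees by `p`. -/
theorem T_smul_mem_iSup_Icc_tensorTPow {R : Type*} [CommRing R] {Q : Type*} [AddCommGroup Q]
    [Module R Q] {a b : ℤ} (p : ℤ) {z : R[T;T⁻¹] ⊗[R] Q}
    (hz : z ∈ ⨆ q ∈ Finset.Icc a b, tensorTPow R Q q) :
    (T p : R[T;T⁻¹]) • z ∈ ⨆ q ∈ Finset.Icc (p + a) (p + b), tensorTPow R Q q := by
  suffices h : (⨆ q ∈ Finset.Icc a b, tensorTPow R Q q) ≤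
      (⨆ q ∈ Finset.Icc (p + a) (p + b), tensorTPow R Q q).comap
        (Algebra.lsmul R R (R[T;T⁻¹] ⊗[R] Q) (T p : R[T;T⁻¹])) from h hz
  refine iSup₂_le fun q hq => ?_
  rintro _ ⟨x, rfl⟩
  refine Submodule.mem_iSup_of_mem (p + q) (Submodule.mem_iSup_of_mem ?_ ⟨x, ?_⟩)
  · rw [Finset.mem_Icc] at hq ⊢
    omega
  · rw [TensorProduct.mk_apply, LaurentPolynomial.T_add, Algebra.lsmul_coe, TensorProduct.mk_apply]
    exact (TensorProduct.smul_tmul' (R := R) (T p : R[T;T⁻¹]) (T q : R[T;T⁻¹]) x).symm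

/-- Let `R` be a commutative ring, `P` a finitely generated `R`-module,
`Q` an `R`-module, and `α : P ⊗_R R[T,T⁻¹] → Q ⊗_R R[T,T⁻¹]` an `R[T,T⁻¹]`-linear map
between the base changes to the Laurent polynomial ring.  Then there is an `N ∈ ℕ` such
that for every `p ∈ ℤ`, `α` maps the `R`-submodule `P ⊗ T^p` into the `R`-submodule
`Σ_{q = p − N}^{p + N} Q ⊗ T^q`. -/
theorem laurent_linear_map_bounded_bandwidth (R : Type*) [CommRing R]
    (P : Type*) [AddCommGroup P] [Module R P] [Module.Finite R P]
    (Q : Type*) [AddCommGroup Q] [Module R Q]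
    (α : TensorProduct R (LaurentPolynomial R) P →ₗ[LaurentPolynomial R]
      TensorProduct R (LaurentPolynomial R) Q) :
    ∃ N : ℕ, ∀ p : ℤ,
      (tensorTPow R P p).map (α.restrictScalars R) ≤
        ⨆ q ∈ Finset.Icc (p - (N : ℤ)) (p + (N : ℤ)), tensorTPow R Q q := by
  obtain ⟨S, hS⟩ := Module.Finite.fg_top (R := R) (M := P)
  choose N hN using fun x : P =>
    exists_mem_iSup_Icc_tensorTPow (α (TensorProduct.mk R (LaurentPolynomial R) P 1 x))
  refine ⟨S.sup N, fun p => ?_⟩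
  have key : (⊤ : Submodule R P) ≤
      (⨆ q ∈ Finset.Icc (-((S.sup N : ℕ) : ℤ)) (S.sup N : ℕ), tensorTPow R Q q).comap
        (α.restrictScalars R ∘ₗ TensorProduct.mk R (LaurentPolynomial R) P 1) := by
    rw [← hS, Submodule.span_le]
    intro x hx
    exact iSup_Icc_tensorTPow_mono (Finset.le_sup hx) (hN x)
  rintro _ ⟨_, ⟨x, rfl⟩, rfl⟩
  have h := T_smul_mem_iSup_Icc_tensorTPow p (key (Submodule.mem_top (x := x)))
  rw [← sub_eq_add_neg] at h
  convert h using 1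
  simp [← map_smul, TensorProduct.smul_tmul']
end
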